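/- Let ψ : ℝ → ℝ be continuously differentiable with |ψ| and |ψ'| bounded by a polynomial, let σ* > 0, σ_b ≥ 0, s > 0 satisfy the norm fixed-point equation σ*² · E[ψ(s·G)²] + σ_b² = s² (G a standard Gaussian), and define g3 : [-1,1] → ℝ by g3(ρ) = ( σ*² · E[ψ(s·Z1)·ψ(s·Z2)] + σ_b² ) / s², where (Z1, Z2) is the centered bivariate Gaussian pair with unit variances and correlation ρ. Suppose there exists λ < 1 such that σ*² · |E[ψ'(s·Z1)·ψ'(s·Z2)]| ≤ λ for all ρ ∈ (-1,1). Then g3 maps [-1,1] into [-1,1], g3(1) = 1, ρ = 1 is the unique fixed point of g3 in [-1,1], and for every ρ ∈ [-1,1] and every n ∈ ℕ, |g3^n(ρ) − 1| ≤ λ^n · |ρ − 1|, where g3^n denotes the n-fold iterate. -/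

import Mathlib

open Real MeasureTheory Set

/-- Standard Gaussian probability density function. -/
noncomputable def gpdf (x : ℝ) : ℝ := (Real.sqrt (2 * Real.pi))⁻¹ * Real.exp (-(x ^ 2) / 2)

open ProbabilityTheory

lemma gpdf_eq_gaussianPDFReal : gpdf = gaussianPDFReal 0 1 := by
  ext x
  simp [gpdf, gaussianPDFReal_def]

lemma integral_mul_gpdf (f : ℝ → ℝ) : ∫ x, f x * gpdf x = ∫ x, f x ∂(gaussianReal 0 1) := by
  rw [integral_gaussianReal_eq_integral_smul one_ne_zero, gpdf_eq_gaussianPDFReal]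
  simp only [smul_eq_mul, mul_comm]

lemma integrable_mul_gpdf_iff {f : ℝ → ℝ} :
    Integrable (fun x => f x * gpdf x) ↔ Integrable f (gaussianReal 0 1) := by
  rw [gaussianReal_of_var_ne_zero 0 one_ne_zero,
    integrable_withDensity_iff_integrable_smul' (measurable_gaussianPDF 0 1)
      (by simp [gaussianPDF_lt_top]), gpdf_eq_gaussianPDFReal]
  simp only [toReal_gaussianPDF, smul_eq_mul, mul_comm]

lemma integral_integral_mul_gpdf_mul_gpdf {f : ℝ × ℝ → ℝ}
    (hf : Integrable f ((gaussianReal 0 1).prod (gaussianReal 0 1))) :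
    ∫ x : ℝ, ∫ y : ℝ, f (x, y) * gpdf x * gpdf y =
      ∫ p, f p ∂((gaussianReal 0 1).prod (gaussianReal 0 1)) := by
  rw [integral_prod f hf, ← integral_mul_gpdf]
  congr 1 with x
  rw [← integral_mul_gpdf, ← integral_mul_const]
  congr 1 with y
  ring

lemma hasDerivAt_gpdf (x : ℝ) : HasDerivAt gpdf (-(x * gpdf x)) x := by
  have h : HasDerivAt (fun x : ℝ => -(x ^ 2) / 2) (-x) x :=
    ((hasDerivAt_pow 2 x).neg.div_const 2).congr_deriv (by push_cast; ring)
  refine (h.exp.const_mul (Real.sqrt (2 * Real.pi))⁻¹).congr_deriv ?_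
  simp only [gpdf]
  ring

/-- Gaussian integration by parts. -/
lemma integral_mul_id_gaussianReal {f f' : ℝ → ℝ} (hf : ∀ x, HasDerivAt f (f' x) x)
    (hf_int : Integrable f (gaussianReal 0 1)) (hf'_int : Integrable f' (gaussianReal 0 1))
    (hfx_int : Integrable (fun x => f x * x) (gaussianReal 0 1)) :
    ∫ x, f x * x ∂(gaussianReal 0 1) = ∫ x, f' x ∂(gaussianReal 0 1) := by
  rw [← integrable_mul_gpdf_iff] at hf_int hf'_int hfx_int
  have key := integral_mul_deriv_eq_deriv_mul_of_integrable (u := f) (u' := f') (v := gpdf)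
    (v' := fun x => -(x * gpdf x)) (fun x _ => hf x) (fun x _ => hasDerivAt_gpdf x)
    (by simpa [Pi.mul_def, mul_assoc] using hfx_int.neg) hf'_int hf_int
  rw [← integral_mul_gpdf, ← integral_mul_gpdf, ← neg_inj, ← key, ← integral_neg]
  congr 1 with x
  ring

lemma integrable_of_abs_le_one_add_norm_pow {E : Type*} [NormedAddCommGroup E] [NormedSpace ℝ E]
    [CompleteSpace E] [SecondCountableTopology E] [MeasurableSpace E] [BorelSpace E]
    {μ : Measure E} [IsGaussian μ] {f : E → ℝ} (hf : Continuous f) {C : ℝ} {k : ℕ}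
    (hb : ∀ x, |f x| ≤ C * (1 + ‖x‖) ^ k) : Integrable f μ := by
  have h : Integrable (fun x : E => (1 + ‖x‖) ^ k) μ := by
    have h0 : MemLp (fun x : E => ‖x‖) k μ := (IsGaussian.memLp_id μ k (by simp)).norm
    have h1 : MemLp (fun x : E => 1 + ‖x‖) k μ := (memLp_const (1 : ℝ)).add h0
    refine h1.integrable_norm_pow'.congr (ae_of_all _ fun x => ?_)
    simp only [Real.norm_of_nonneg (by positivity : 0 ≤ 1 + ‖x‖)]
  exact (h.const_mul C).mono' hf.aestronglyMeasurable (ae_of_all _ hb)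

lemma integral_comp_rotation (θ : ℝ) {F : ℝ × ℝ → ℝ} (hF : Continuous F) :
    ∫ p, F (ContinuousLinearMap.rotation θ p) ∂((gaussianReal 0 1).prod (gaussianReal 0 1)) =
      ∫ p, F p ∂((gaussianReal 0 1).prod (gaussianReal 0 1)) := by
  have h := IsGaussian.map_rotation_eq_self (μ := gaussianReal 0 1) (by simp) θ
  conv_rhs => rw [← h]
  rw [integral_map (by fun_prop) hF.aestronglyMeasurable]

lemma abs_trig_combination_le (a b : ℝ) {u v : ℝ} (hu : |u| ≤ 1) (hv : |v| ≤ 1) :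
    |u * a + v * b| ≤ 2 * ‖((a, b) : ℝ × ℝ)‖ := by
  have ha : |a| ≤ ‖((a, b) : ℝ × ℝ)‖ := norm_fst_le (a, b)
  have hb : |b| ≤ ‖((a, b) : ℝ × ℝ)‖ := norm_snd_le (a, b)
  calc |u * a + v * b| ≤ |u| * |a| + |v| * |b| := by
        simpa only [abs_mul] using abs_add_le (u * a) (v * b)
    _ ≤ 1 * |a| + 1 * |b| := by gcongr
    _ ≤ _ := by linarith

section Covariance

variable {φ φ' : ℝ → ℝ} {C : ℝ} {k : ℕ}

lemma abs_comp_le_of_polynomial_bound (hC : 0 ≤ C) (hb : ∀ x, |φ x| ≤ C * (1 + |x|) ^ k)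
    {t r : ℝ} (ht : |t| ≤ 2 * r) : |φ t| ≤ C * 2 ^ k * (1 + r) ^ k := by
  refine (hb t).trans ?_
  rw [mul_assoc, ← mul_pow]
  gcongr
  linarith

lemma integrable_mul_comp_trig {χ : ℝ → ℝ} (hC : 0 ≤ C) (hφ : Continuous φ) (hχ : Continuous χ)
    (hb : ∀ x, |φ x| ≤ C * (1 + |x|) ^ k) (hb' : ∀ x, |χ x| ≤ C * (1 + |x|) ^ k)
    {u v u' v' : ℝ} (hu : |u| ≤ 1) (hv : |v| ≤ 1) (hu' : |u'| ≤ 1) (hv' : |v'| ≤ 1) :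
    Integrable (fun p : ℝ × ℝ => φ (u * p.1 + v * p.2) * χ (u' * p.1 + v' * p.2))
      ((gaussianReal 0 1).prod (gaussianReal 0 1)) := by
  refine integrable_of_abs_le_one_add_norm_pow (by fun_prop)
    (C := (C * 2 ^ k) * (C * 2 ^ k)) (k := k + k) fun p => ?_
  rw [abs_mul, pow_add, mul_mul_mul_comm]
  exact mul_le_mul
    (abs_comp_le_of_polynomial_bound hC hb (abs_trig_combination_le _ _ hu hv))
    (abs_comp_le_of_polynomial_bound hC hb' (abs_trig_combination_le _ _ hu' hv'))
    (abs_nonneg _) (by positivity)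

lemma abs_mul_mul_le_of_polynomial_bound {χ : ℝ → ℝ} (hC : 0 ≤ C)
    (hb : ∀ x, |φ x| ≤ C * (1 + |x|) ^ k) (hb' : ∀ x, |χ x| ≤ C * (1 + |x|) ^ k)
    {t t' w r : ℝ} (hr : 0 ≤ r) (ht : |t| ≤ 2 * r) (ht' : |t'| ≤ 2 * r) (hw : |w| ≤ 2 * r) :
    |φ t * χ t' * w| ≤ (C * 2 ^ k) * (C * 2 ^ k) * 2 * (1 + r) ^ (k + k + 1) := by
  have h1 := abs_comp_le_of_polynomial_bound hC hb ht
  have h2 := abs_comp_le_of_polynomial_bound hC hb' ht'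
  calc |φ t * χ t' * w| = |φ t| * |χ t'| * |w| := by rw [abs_mul, abs_mul]
    _ ≤ (C * 2 ^ k * (1 + r) ^ k) * (C * 2 ^ k * (1 + r) ^ k) * (2 * (1 + r)) := by
        gcongr
        linarith
    _ = _ := by ring

/-- The derivative of the covariance of `φ` along a pair of standard Gaussians with
correlation `cos θ`. -/
lemma hasDerivAt_gaussian_covariance (hC : 0 ≤ C) (hφ : ∀ x, HasDerivAt φ (φ' x) x)
    (hφ' : Continuous φ') (hb : ∀ x, |φ x| ≤ C * (1 + |x|) ^ k)
    (hb' : ∀ x, |φ' x| ≤ C * (1 + |x|) ^ k) (θ : ℝ) :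
    HasDerivAt (fun θ => ∫ p : ℝ × ℝ, φ p.1 * φ (cos θ * p.1 + sin θ * p.2)
        ∂((gaussianReal 0 1).prod (gaussianReal 0 1)))
      (-sin θ * ∫ p : ℝ × ℝ, φ' p.1 * φ' (cos θ * p.1 + sin θ * p.2)
        ∂((gaussianReal 0 1).prod (gaussianReal 0 1))) θ := by
  have hφc : Continuous φ := continuous_iff_continuousAt.2 fun x => (hφ x).continuousAt
  have hs : ∀ θ, |(-sin θ)| ≤ 1 := fun θ => by rw [abs_neg]; exact abs_sin_le_one θ
  have hfst : ∀ p : ℝ × ℝ, |p.1| ≤ 2 * ‖p‖ := fun p =>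
    (norm_fst_le p).trans (by linarith [norm_nonneg p])
  have hsnd : ∀ p : ℝ × ℝ, |p.2| ≤ 2 * ‖p‖ := fun p =>
    (norm_snd_le p).trans (by linarith [norm_nonneg p])
  have hf_int : Integrable (fun p : ℝ × ℝ => φ p.1 * φ (cos θ * p.1 + sin θ * p.2))
      ((gaussianReal 0 1).prod (gaussianReal 0 1)) := by
    simpa using integrable_mul_comp_trig hC hφc hφc hb hb (u := 1) (v := 0) (by simp)
      (by simp) (abs_cos_le_one θ) (abs_sin_le_one θ)
  have hderiv := (hasDerivAt_integral_of_dominated_loc_of_deriv_le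
    (μ := (gaussianReal 0 1).prod (gaussianReal 0 1)) (x₀ := θ) (s := univ)
    (F := fun θ (p : ℝ × ℝ) => φ p.1 * φ (cos θ * p.1 + sin θ * p.2))
    (F' := fun θ (p : ℝ × ℝ) => φ p.1 * φ' (cos θ * p.1 + sin θ * p.2) *
      (-sin θ * p.1 + cos θ * p.2))
    (bound := fun p => (C * 2 ^ k) * (C * 2 ^ k) * 2 * (1 + ‖p‖) ^ (k + k + 1))
    Filter.univ_mem (Filter.Eventually.of_forall fun θ =>
      Continuous.aestronglyMeasurable (by fun_prop))
    hf_int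
    (Continuous.aestronglyMeasurable (by fun_prop))
    (ae_of_all _ fun p θ _ => abs_mul_mul_le_of_polynomial_bound hC hb hb' (norm_nonneg p)
      (hfst p) (abs_trig_combination_le _ _ (abs_cos_le_one θ) (abs_sin_le_one θ))
      (abs_trig_combination_le _ _ (hs θ) (abs_cos_le_one θ)))
    (integrable_of_abs_le_one_add_norm_pow (by fun_prop) fun p => (abs_of_nonneg
      (by positivity)).le)
    (ae_of_all _ fun p θ _ => by
      have h1 : HasDerivAt (fun θ => cos θ * p.1 + sin θ * p.2)
          (-sin θ * p.1 + cos θ * p.2) θ :=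
        ((hasDerivAt_cos θ).mul_const _).add ((hasDerivAt_sin θ).mul_const _)
      exact (((hφ _).comp θ h1).const_mul (φ p.1)).congr_deriv (mul_assoc _ _ _).symm)).2
  refine hderiv.congr_deriv ?_
  have hc2 := cos_sq_add_sin_sq θ
  have hfstL : ∀ p : ℝ × ℝ, cos θ * (cos θ * p.1 + sin θ * p.2) -
      sin θ * (-sin θ * p.1 + cos θ * p.2) = p.1 := fun p => by
    linear_combination p.1 * hc2
  have rot1 := integral_comp_rotation θ
    (F := fun p => φ (cos θ * p.1 + -sin θ * p.2) * φ' p.1 * p.2) (by fun_prop)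
  have rot2 := integral_comp_rotation θ
    (F := fun p => φ' (cos θ * p.1 + -sin θ * p.2) * φ' p.1) (by fun_prop)
  simp only [ContinuousLinearMap.rotation_apply, smul_eq_mul, neg_mul, ← sub_eq_add_neg]
    at rot1 rot2 hfstL ⊢
  simp only [hfstL] at rot1 rot2
  rw [rot1, rot2]
  symm
  have hi0 : Integrable (fun p : ℝ × ℝ => φ (cos θ * p.1 - sin θ * p.2) * φ' p.1)
      ((gaussianReal 0 1).prod (gaussianReal 0 1)) := by
    simpa [sub_eq_add_neg] using integrable_mul_comp_trig hC hφc hφ' hb hb' (u' := 1) (v' := 0)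
      (abs_cos_le_one θ) (hs θ) (by simp) (by simp)
  have hi1 : Integrable (fun p : ℝ × ℝ => φ' (cos θ * p.1 - sin θ * p.2) * φ' p.1)
      ((gaussianReal 0 1).prod (gaussianReal 0 1)) := by
    simpa [sub_eq_add_neg] using integrable_mul_comp_trig hC hφ' hφ' hb' hb' (u' := 1) (v' := 0)
      (abs_cos_le_one θ) (hs θ) (by simp) (by simp)
  have hi2 : Integrable (fun p : ℝ × ℝ => φ (cos θ * p.1 - sin θ * p.2) * φ' p.1 * p.2)
      ((gaussianReal 0 1).prod (gaussianReal 0 1)) :=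
    integrable_of_abs_le_one_add_norm_pow (by fun_prop) fun p =>
      abs_mul_mul_le_of_polynomial_bound hC hb hb' (norm_nonneg p)
        (by simpa [sub_eq_add_neg] using
          abs_trig_combination_le p.1 p.2 (abs_cos_le_one θ) (hs θ)) (hfst p) (hsnd p)
  rw [integral_prod _ hi1, integral_prod _ hi2, ← neg_mul, ← integral_const_mul]
  refine integral_congr_ae ?_
  filter_upwards [hi0.prod_right_ae, hi1.prod_right_ae, hi2.prod_right_ae] with x h0 h1 h2
  rw [integral_mul_id_gaussianReal (f' := fun y =>
    -sin θ * (φ' (cos θ * x - sin θ * y) * φ' x)) (fun y => ?_) h0 (h1.const_mul _) h2,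
    integral_const_mul]
  have h3 : HasDerivAt (fun y => cos θ * x - sin θ * y) (-sin θ) y := by
    simpa using ((hasDerivAt_id y).const_mul (sin θ)).const_sub (cos θ * x)
  exact (((hφ _).comp y h3).mul_const (φ' x)).congr_deriv (by ring)

/-- The Cauchy–Schwarz bound for the covariance of `φ` along a pair of standard Gaussians with
correlation `cos θ`. -/
lemma abs_gaussian_covariance_le (hC : 0 ≤ C) (hφ : Continuous φ)
    (hb : ∀ x, |φ x| ≤ C * (1 + |x|) ^ k) (θ : ℝ) :
    |∫ p : ℝ × ℝ, φ p.1 * φ (cos θ * p.1 + sin θ * p.2)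
        ∂((gaussianReal 0 1).prod (gaussianReal 0 1))| ≤
      ∫ p : ℝ × ℝ, φ p.1 * φ p.1 ∂((gaussianReal 0 1).prod (gaussianReal 0 1)) := by
  have i1 : Integrable (fun p : ℝ × ℝ => φ p.1 * φ p.1)
      ((gaussianReal 0 1).prod (gaussianReal 0 1)) := by
    simpa using integrable_mul_comp_trig hC hφ hφ hb hb (u := 1) (v := 0) (u' := 1) (v' := 0)
      (by simp) (by simp) (by simp) (by simp)
  have i2 := integrable_mul_comp_trig hC hφ hφ hb hb (abs_cos_le_one θ) (abs_sin_le_one θ)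
    (abs_cos_le_one θ) (abs_sin_le_one θ)
  have rot := integral_comp_rotation θ (F := fun p => φ p.1 * φ p.1) (by fun_prop)
  simp only [ContinuousLinearMap.rotation_apply, smul_eq_mul] at rot
  calc _ ≤ ∫ p : ℝ × ℝ, 2⁻¹ * (φ p.1 * φ p.1 + φ (cos θ * p.1 + sin θ * p.2) *
          φ (cos θ * p.1 + sin θ * p.2)) ∂((gaussianReal 0 1).prod (gaussianReal 0 1)) := by
        rw [← Real.norm_eq_abs]
        refine norm_integral_le_of_norm_le ((i1.add i2).const_mul 2⁻¹) (ae_of_all _ fun p => ?_)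
        rw [Real.norm_eq_abs, abs_le]
        constructor
        · linarith [mul_self_nonneg (φ p.1 + φ (cos θ * p.1 + sin θ * p.2))]
        · linarith [mul_self_nonneg (φ p.1 - φ (cos θ * p.1 + sin θ * p.2))]
    _ = _ := by
        rw [integral_const_mul, integral_add i1 i2, rot]
        ring

end Covariance

/-- Unique fixed point of the normalised kernel map.  Let `ψ` be continuously
differentiable with `|ψ|` and `|ψ'|` polynomially bounded, let `σ* > 0`, `σ_b ≥ 0`,
`s > 0` satisfy the norm fixed-point equation `σ*²·E[ψ(s·G)²] + σ_b² = s²`, and let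
`g3(ρ) = (σ*²·E[ψ(s·Z₁)·ψ(s·Z₂)] + σ_b²)/s²`, where `(Z₁, Z₂)` is the centered bivariate
Gaussian pair with unit variances and correlation `ρ`, realised as `Z₁ = x`,
`Z₂ = ρ·x + √(1−ρ²)·y` for independent standard Gaussians.  If `λ < 1` bounds
`σ*²·|E[ψ'(s·Z₁)·ψ'(s·Z₂)]|` on `(-1,1)`, then `g3` maps `[-1,1]` into `[-1,1]`,
`g3 1 = 1`, `ρ = 1` is the unique fixed point of `g3` in `[-1,1]`, and
`|g3^[n] ρ − 1| ≤ λ^n·|ρ − 1|` for all `ρ ∈ [-1,1]` and `n ∈ ℕ`. -/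
theorem g3_unique_fixed_point (ψ : ℝ → ℝ) (hψ : ContDiff ℝ 1 ψ)
    (c : ℝ) (hc : 0 < c) (m : ℕ)
    (hb : ∀ x : ℝ, |ψ x| ≤ c * (1 + |x|) ^ m)
    (hb' : ∀ x : ℝ, |deriv ψ x| ≤ c * (1 + |x|) ^ m)
    (σStar σb s : ℝ) (hσStar : 0 < σStar) (hσb : 0 ≤ σb) (hs : 0 < s)
    (hfix : σStar ^ 2 * (∫ z : ℝ, (ψ (s * z)) ^ 2 * gpdf z) + σb ^ 2 = s ^ 2)
    (g3 : ℝ → ℝ)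
    (hg3 : ∀ ρ : ℝ, g3 ρ =
      (σStar ^ 2 * (∫ x : ℝ, ∫ y : ℝ,
          ψ (s * x) * ψ (s * (ρ * x + Real.sqrt (1 - ρ ^ 2) * y)) * gpdf x * gpdf y)
        + σb ^ 2) / s ^ 2)
    (lam : ℝ) (hlam : lam < 1)
    (hcontract : ∀ ρ ∈ Set.Ioo (-1 : ℝ) 1,
      σStar ^ 2 * |∫ x : ℝ, ∫ y : ℝ,
          deriv ψ (s * x) * deriv ψ (s * (ρ * x + Real.sqrt (1 - ρ ^ 2) * y)) *
            gpdf x * gpdf y| ≤ lam) :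
    Set.MapsTo g3 (Set.Icc (-1 : ℝ) 1) (Set.Icc (-1 : ℝ) 1) ∧
    g3 1 = 1 ∧
    (∀ ρ ∈ Set.Icc (-1 : ℝ) 1, g3 ρ = ρ → ρ = 1) ∧
    (∀ ρ ∈ Set.Icc (-1 : ℝ) 1, ∀ n : ℕ, |g3^[n] ρ - 1| ≤ lam ^ n * |ρ - 1|) := by
  have hψc : Continuous ψ := hψ.continuous
  have hψ'c : Continuous (deriv ψ) := hψ.continuous_deriv le_rfl
  have hs2 : (s ^ 2 : ℝ) ≠ 0 := by positivity
  have hC : 0 ≤ c * (1 + s) ^ m * (1 + s) := by positivity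
  have scale : ∀ x : ℝ, c * (1 + |s * x|) ^ m ≤ c * (1 + s) ^ m * (1 + |x|) ^ m := fun x => by
    rw [mul_assoc, ← mul_pow, abs_mul, abs_of_pos hs]
    gcongr
    nlinarith [abs_nonneg x]
  have hφb : ∀ x, |ψ (s * x)| ≤ c * (1 + s) ^ m * (1 + s) * (1 + |x|) ^ m := fun x => by
    refine ((hb _).trans (scale x)).trans ?_
    gcongr ?_ * _
    exact le_mul_of_one_le_right (by positivity) (by linarith)
  have hdb : ∀ x, |deriv ψ (s * x)| ≤ c * (1 + s) ^ m * (1 + s) * (1 + |x|) ^ m := fun x => by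
    refine ((hb' _).trans (scale x)).trans ?_
    gcongr ?_ * _
    exact le_mul_of_one_le_right (by positivity) (by linarith)
  have hφb' : ∀ x, |s * deriv ψ (s * x)| ≤ c * (1 + s) ^ m * (1 + s) * (1 + |x|) ^ m := fun x => by
    rw [abs_mul, abs_of_pos hs]
    calc s * |deriv ψ (s * x)| ≤ (1 + s) * (c * (1 + s) ^ m * (1 + |x|) ^ m) :=
          mul_le_mul (by linarith) ((hb' _).trans (scale x)) (abs_nonneg _) (by positivity)
      _ = _ := by ring
  have hφd : ∀ x, HasDerivAt (fun x => ψ (s * x)) (s * deriv ψ (s * x)) x := fun x => by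
    have h1 : HasDerivAt (fun x => s * x) s x := by simpa using (hasDerivAt_id x).const_mul s
    exact ((hψ.differentiable one_ne_zero (s * x)).hasDerivAt.comp x h1).congr_deriv (mul_comm _ _)
  have hφc : Continuous fun x => ψ (s * x) := by fun_prop
  have hdc : Continuous fun x => deriv ψ (s * x) := by fun_prop
  have hsin : ∀ θ ∈ Icc 0 π, √(1 - cos θ ^ 2) = sin θ := fun θ hθ => by
    rw [← sin_sq, sqrt_sq (sin_nonneg_of_mem_Icc hθ)]
  set F : ℝ → ℝ := fun θ => ∫ p : ℝ × ℝ, ψ (s * p.1) * ψ (s * (cos θ * p.1 + sin θ * p.2))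
    ∂((gaussianReal 0 1).prod (gaussianReal 0 1)) with hF
  set D : ℝ → ℝ := fun θ => ∫ p : ℝ × ℝ,
    deriv ψ (s * p.1) * deriv ψ (s * (cos θ * p.1 + sin θ * p.2))
    ∂((gaussianReal 0 1).prod (gaussianReal 0 1)) with hD
  have hF0 : F 0 = ∫ z : ℝ, ψ (s * z) ^ 2 * gpdf z := by
    rw [integral_mul_gpdf]
    simpa [hF, sq] using integral_fun_fst (μ := gaussianReal 0 1) (ν := gaussianReal 0 1)
      (fun x => ψ (s * x) * ψ (s * x))
  have hFg : ∀ θ ∈ Icc 0 π, g3 (cos θ) = (σStar ^ 2 * F θ + σb ^ 2) / s ^ 2 := fun θ hθ => by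
    have hi := integrable_mul_comp_trig hC hφc hφc hφb hφb (u := 1) (v := 0) (by simp) (by simp)
      (abs_cos_le_one θ) (abs_sin_le_one θ)
    simp only [one_mul, zero_mul, add_zero] at hi
    rw [hg3, hsin θ hθ, integral_integral_mul_gpdf_mul_gpdf hi]
  have hDle : ∀ θ ∈ Ioo 0 π, σStar ^ 2 * |D θ| ≤ lam := fun θ hθ => by
    have hi := integrable_mul_comp_trig hC hdc hdc hdb hdb (u := 1) (v := 0) (by simp) (by simp)
      (abs_cos_le_one θ) (abs_sin_le_one θ)
    simp only [one_mul, zero_mul, add_zero] at hi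
    have hmem : cos θ ∈ Ioo (-1 : ℝ) 1 := by
      have h1 := strictAntiOn_cos ⟨hθ.1.le, hθ.2.le⟩ (right_mem_Icc.2 pi_pos.le) hθ.2
      have h2 := strictAntiOn_cos (left_mem_Icc.2 pi_pos.le) ⟨hθ.1.le, hθ.2.le⟩ hθ.1
      exact ⟨by simpa using h1, by simpa using h2⟩
    have := hcontract _ hmem
    rwa [hsin θ ⟨hθ.1.le, hθ.2.le⟩, integral_integral_mul_gpdf_mul_gpdf hi] at this
  have hlam0 : 0 ≤ lam :=
    le_trans (by positivity) (hDle (π / 2) ⟨by positivity, by linarith [pi_pos]⟩)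
  have hFderiv : ∀ θ, HasDerivAt F (-sin θ * (s ^ 2 * D θ)) θ := fun θ => by
    convert hasDerivAt_gaussian_covariance hC hφd (by fun_prop) hφb hφb' θ using 2
    rw [hD, ← integral_const_mul]
    congr 1 with p
    ring
  rw [← hF0] at hfix
  have hderiv : ∀ θ, HasDerivAt (fun θ => (σStar ^ 2 * F θ + σb ^ 2) / s ^ 2 - 1)
      (-sin θ * (σStar ^ 2 * D θ)) θ := fun θ => by
    refine ((((hFderiv θ).const_mul (σStar ^ 2)).add_const (σb ^ 2)).div_const
      (s ^ 2)).sub_const 1 |>.congr_deriv ?_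
    field_simp
  have hcos : ∀ θ ∈ Icc 0 π, |(σStar ^ 2 * F θ + σb ^ 2) / s ^ 2 - 1| ≤ lam * (1 - cos θ) := by
    refine image_norm_le_of_norm_deriv_right_le_deriv_boundary
      (f' := fun θ => -sin θ * (σStar ^ 2 * D θ)) (B' := fun θ => lam * sin θ)
      (fun θ _ => (hderiv θ).continuousAt.continuousWithinAt)
      (fun θ _ => (hderiv θ).hasDerivWithinAt) ?_ (fun θ => ?_) ?_
    · simp [hfix, div_self hs2]
    · simpa using ((hasDerivAt_cos θ).const_sub 1).const_mul lam
    · intro θ hθ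
      rcases hθ.1.eq_or_lt with rfl | h0
      · simp
      · have h1 := sin_nonneg_of_mem_Icc ⟨hθ.1, hθ.2.le⟩
        have h2 := hDle θ ⟨h0, hθ.2⟩
        rw [norm_mul, norm_neg, Real.norm_of_nonneg h1, norm_mul,
          Real.norm_of_nonneg (by positivity : 0 ≤ σStar ^ 2), mul_comm lam]
        exact mul_le_mul_of_nonneg_left h2 h1
  have harccos : ∀ ρ ∈ Icc (-1 : ℝ) 1, ∃ θ ∈ Icc 0 π, cos θ = ρ := fun ρ hρ =>
    ⟨arccos ρ, ⟨arccos_nonneg ρ, arccos_le_pi ρ⟩, cos_arccos hρ.1 hρ.2⟩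
  have hstep : ∀ ρ ∈ Icc (-1 : ℝ) 1, |g3 ρ - 1| ≤ lam * |ρ - 1| := fun ρ hρ => by
    obtain ⟨θ, hθ, rfl⟩ := harccos ρ hρ
    rw [hFg θ hθ, abs_sub_comm (cos θ), abs_of_nonneg (by linarith [cos_le_one θ] : 0 ≤ 1 - cos θ)]
    exact hcos θ hθ
  have hmaps : MapsTo g3 (Icc (-1 : ℝ) 1) (Icc (-1 : ℝ) 1) := fun ρ hρ => by
    obtain ⟨θ, hθ, rfl⟩ := harccos ρ hρ
    have hle : |F θ| ≤ F 0 := by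
      simpa [hF] using abs_gaussian_covariance_le hC hφc hφb θ
    rw [abs_le] at hle
    have h1 := mul_le_mul_of_nonneg_left hle.1 (sq_nonneg σStar)
    have h2 := mul_le_mul_of_nonneg_left hle.2 (sq_nonneg σStar)
    rw [hFg θ hθ]
    constructor
    · rw [le_div_iff₀ (by positivity)]
      linarith [sq_nonneg σb]
    · rw [div_le_one (by positivity)]
      linarith
  refine ⟨hmaps, ?_, fun ρ hρ h => ?_, fun ρ hρ n => ?_⟩
  · have := hstep 1 (by simp)
    rw [sub_self, abs_zero, mul_zero] at this
    exact sub_eq_zero.1 (abs_nonpos_iff.1 this)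
  · have := hstep ρ hρ
    rw [h] at this
    have h0 : |ρ - 1| ≤ 0 := by nlinarith [abs_nonneg (ρ - 1)]
    exact sub_eq_zero.1 (abs_nonpos_iff.1 h0)
  · induction n with
    | zero => simp
    | succ n ih =>
      rw [Function.iterate_succ_apply', pow_succ', mul_assoc]
      exact (hstep _ (hmaps.iterate n hρ)).trans (mul_le_mul_of_nonneg_left ih hlam0)
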